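/- arXiv:2208.14697 — 7 statements merged into one kernel-verified Lean document; each statement's English description precedes it below -/
import Mathlib

section
/- Let n ≥ 2, let F = (f_{k,j})_{k,j=1}^n be a matrix-valued function on (0,1) with complex entries, and let F⋆ = (f⋆_{k,j}) be defined by f⋆_{k,j}(x) = (−1)^{k+j+1} f_{n−j+1,n−k+1}(x). Let (y_0,…,y_n) be a quasi-derivative chain with respect to F and (z_0,…,z_n) a quasi-derivative chain with respect to F⋆, and let x ∈ (0,1) be a point at which both chains hold. Then the function t ↦ Σ_{j=0}^{n−1} (−1)^j z_j(t) y_{n−1−j}(t) is differentiable at x with derivative z_0(x)·y_n(x) − (−1)^n · y_0(x)·z_n(x). -/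
/-- A quasi-derivative chain `y₀, …, yₙ` with respect to the matrix function
`f` (with 1-based indices `f k j`, `1 ≤ k, j ≤ n`) holds at a point `x` if for each
`k = 1,…,n` the function `y_{k-1}` is differentiable at `x` with derivative
`y_k(x) + ∑_{j=1}^k f_{k,j}(x) · y_{j-1}(x)`. -/
def QuasiChainAt (n : ℕ) (f : ℕ → ℕ → ℝ → ℂ) (y : ℕ → ℝ → ℂ) (x : ℝ) : Prop :=
  ∀ k, 1 ≤ k → k ≤ n →
    HasDerivAt (y (k - 1))
      (y k x + ∑ j ∈ Finset.Icc 1 k, f k j x * y (j - 1) x) x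

theorem sum_Icc_one_eq_sum_range_ite {M : Type*} [AddCommMonoid M] {n m : ℕ} (hm : m < n)
    (g : ℕ → M) :
    ∑ i ∈ Finset.Icc 1 (m + 1), g i = ∑ i ∈ Finset.range n, if i ≤ m then g (i + 1) else 0 := by
  rw [← Finset.sum_filter]
  refine Finset.sum_nbij' (fun i => i - 1) (fun i => i + 1) ?_ ?_ ?_ ?_ ?_ <;> intro i hi <;>
    simp only [Finset.mem_Icc, Finset.mem_filter, Finset.mem_range] at hi ⊢
  · omega
  · omega
  · omega
  · omega
  · rw [Nat.sub_add_cancel hi.1]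

theorem sum_Icc_one_eq_sum_range_ite_reflect {M : Type*} [AddCommMonoid M] {n m : ℕ} (hm : m < n)
    (g : ℕ → M) :
    ∑ i ∈ Finset.Icc 1 (n - m), g i =
      ∑ i ∈ Finset.range n, if m ≤ i then g (n - i) else 0 := by
  rw [← Finset.sum_filter]
  refine Finset.sum_nbij' (fun i => n - i) (fun i => n - i) ?_ ?_ ?_ ?_ ?_ <;> intro i hi <;>
    simp only [Finset.mem_Icc, Finset.mem_filter, Finset.mem_range] at hi ⊢
  · omega
  · omega
  · omega
  · omega
  · rw [Nat.sub_sub_self (by omega)]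

theorem sum_range_alternating_telescope {R : Type*} [CommRing R] (n : ℕ) (a b : ℕ → R) :
    ∑ j ∈ Finset.range n, (-1) ^ j * (a (j + 1) * b (n - 1 - j) + a j * b (n - j)) =
      a 0 * b n - (-1) ^ n * (b 0 * a n) := by
  have h := Finset.sum_range_sub' (fun j => (-1) ^ j * (a j * b (n - j))) n
  simp only [pow_zero, one_mul, Nat.sub_zero, Nat.sub_self] at h
  rw [mul_comm (b 0), ← h]
  refine Finset.sum_congr rfl fun j _ => ?_
  rw [show n - 1 - j = n - (j + 1) by omega]
  ring

theorem pairing_hasDerivAt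
    (n : ℕ) (hn : 2 ≤ n)
    (f fstar : ℕ → ℕ → ℝ → ℂ)
    (hfstar : ∀ k j x, fstar k j x = (-1 : ℂ) ^ (k + j + 1) * f (n - j + 1) (n - k + 1) x)
    (y z : ℕ → ℝ → ℂ) (x : ℝ) (hx : x ∈ Set.Ioo (0 : ℝ) 1)
    (hy : QuasiChainAt n f y x) (hz : QuasiChainAt n fstar z x) :
    HasDerivAt (fun t => ∑ j ∈ Finset.range n, (-1 : ℂ) ^ j * z j t * y (n - 1 - j) t)
      (z 0 x * y n x - (-1 : ℂ) ^ n * (y 0 x * z n x)) x := by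
  have hderiv : ∀ j ∈ Finset.range n, HasDerivAt
      (fun t => (-1 : ℂ) ^ j * z j t * y (n - 1 - j) t)
      ((-1 : ℂ) ^ j * (z (j + 1) x * y (n - 1 - j) x + z j x * y (n - j) x)
        + ((-1 : ℂ) ^ j * z j x * ∑ i ∈ Finset.range n,
              (if j ≤ i then f (n - j) (n - i) x * y (n - 1 - i) x else 0)
          - ∑ i ∈ Finset.range n, (if i ≤ j then
              (-1 : ℂ) ^ i * z i x * (f (n - i) (n - j) x * y (n - 1 - j) x) else 0))) x := by
    intro j hj
    have hjn : j < n := Finset.mem_range.mp hj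
    have hzj := hz (j + 1) (by omega) (by omega)
    have hyj := hy (n - j) (by omega) (by omega)
    rw [sum_Icc_one_eq_sum_range_ite hjn, Nat.add_sub_cancel] at hzj
    rw [sum_Icc_one_eq_sum_range_ite_reflect hjn, show n - j - 1 = n - 1 - j by omega] at hyj
    refine ((hzj.const_mul ((-1 : ℂ) ^ j)).fun_mul hyj).congr_deriv ?_
    have hstar : (∑ i ∈ Finset.range n, (if i ≤ j then
              (-1 : ℂ) ^ i * z i x * (f (n - i) (n - j) x * y (n - 1 - j) x) else 0)) =
        -((-1 : ℂ) ^ j * (∑ i ∈ Finset.range n,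
          if i ≤ j then fstar (j + 1) (i + 1) x * z (i + 1 - 1) x else 0) * y (n - 1 - j) x) := by
      rw [Finset.mul_sum, Finset.sum_mul, ← Finset.sum_neg_distrib]
      refine Finset.sum_congr rfl fun i hi => ?_
      have hin : i < n := Finset.mem_range.mp hi
      split_ifs
      · rw [hfstar, show n - (i + 1) + 1 = n - i by omega,
          show n - (j + 1) + 1 = n - j by omega, Nat.add_sub_cancel]
        have hsq : (-1 : ℂ) ^ j * (-1 : ℂ) ^ j = 1 := by
          rw [← mul_pow]; simp
        linear_combination
          (-(-1 : ℂ) ^ i * z i x * f (n - i) (n - j) x * y (n - 1 - j) x) * hsq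
      · simp
    rw [hstar]
    simp only [Nat.sub_right_comm n _ 1]
    ring
  refine (HasDerivAt.fun_sum hderiv).congr_deriv ?_
  rw [Finset.sum_add_distrib,
    sum_range_alternating_telescope n (fun j => z j x) (fun j => y j x), Finset.sum_sub_distrib]
  conv_lhs => rw [Finset.sum_comm (s := Finset.range n) (t := Finset.range n)
    (f := fun j i => if i ≤ j then
      (-1 : ℂ) ^ i * z i x * (f (n - i) (n - j) x * y (n - 1 - j) x) else 0)]
  simp [Finset.mul_sum, mul_ite]
end

section
/- Let n ≥ 2, let F = (f_{k,j})_{k,j=1}^n be a matrix-valued function on (0,1) with complex integrable entries, and let F⋆ = (f⋆_{k,j}) be defined by f⋆_{k,j}(x) = (−1)^{k+j+1} f_{n−j+1,n−k+1}(x). Let λ, μ ∈ ℂ. Let (y_0,…,y_n) be a quasi-derivative chain with respect to F holding in integrated form on [0,1], with y_n(x) = λ·y_0(x) for a.e. x ∈ (0,1), and let (z_0,…,z_n) be a quasi-derivative chain with respect to F⋆ holding in integrated form on [0,1], with (−1)^n·z_n(x) = μ·z_0(x) for a.e. x ∈ (0,1). Then for all x ∈ [0,1]: Σ_{j=0}^{n−1}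 (−1)^j z_j(x) y_{n−1−j}(x) = Σ_{j=0}^{n−1} (−1)^j z_j(0) y_{n−1−j}(0) + (λ − μ)·∫_0^x y_0(t) z_0(t) dt. In particular, if λ = μ then ⟨z,y⟩ is constant on [0,1]. -/
open MeasureTheory

/-- A quasi-derivative chain `y₀, …, yₙ` with respect to the matrix function
`f` (with 1-based indices `f k j`, `1 ≤ k, j ≤ n`) holds in integrated form on `[0,1]`
if each `y_{k-1}` (`k = 1,…,n`) is continuous on `[0,1]`, the functions
`y_k + ∑_{j=1}^k f_{k,j} · y_{j-1}` are integrable on `(0,1)`, and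
`y_{k-1}(x) = y_{k-1}(0) + ∫_0^x [y_k(t) + ∑_{j=1}^k f_{k,j}(t) · y_{j-1}(t)] dt`
for all `x ∈ [0,1]`. -/
def QuasiChainInt (n : ℕ) (f : ℕ → ℕ → ℝ → ℂ) (y : ℕ → ℝ → ℂ) : Prop :=
  ∀ k, 1 ≤ k → k ≤ n →
    ContinuousOn (y (k - 1)) (Set.Icc 0 1) ∧
    IntegrableOn (fun t => y k t + ∑ j ∈ Finset.Icc 1 k, f k j t * y (j - 1) t)
      (Set.Ioo 0 1) ∧
    ∀ x ∈ Set.Icc (0 : ℝ) 1,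
      y (k - 1) x = y (k - 1) 0 +
        ∫ t in (0 : ℝ)..x, (y k t + ∑ j ∈ Finset.Icc 1 k, f k j t * y (j - 1) t)

theorem AbsolutelyContinuousOnInterval.fun_sum {ι F : Type*} [NormedAddCommGroup F] {a b : ℝ}
    (s : Finset ι) {u : ι → ℝ → F} (hu : ∀ i ∈ s, AbsolutelyContinuousOnInterval (u i) a b) :
    AbsolutelyContinuousOnInterval (fun x ↦ ∑ i ∈ s, u i x) a b := by
  classical
  induction s using Finset.induction_on with
  | empty =>
    simpa using (LipschitzOnWith.of_dist_le_mul (K := 0) (f := fun _ : ℝ ↦ (0 : F))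
      (by simp)).absolutelyContinuousOnInterval (a := a) (b := b)
  | insert i s hi ih =>
    simp only [Finset.sum_insert hi]
    exact (hu i (Finset.mem_insert_self i s)).fun_add
      (ih fun j hj ↦ hu j (Finset.mem_insert_of_mem hj))

/-- An indefinite integral of an integrable function is absolutely continuous. -/
theorem absolutelyContinuousOnInterval_const_add_integral {F : Type*} [NormedAddCommGroup F]
    [NormedSpace ℝ F] {a b : ℝ} {u : ℝ → F} (hu : IntervalIntegrable u volume a b) (c : F) :
    AbsolutelyContinuousOnInterval (fun x ↦ c + ∫ t in a..x, u t) a b := by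
  have hnorm := hu.norm.absolutelyContinuousOnInterval_intervalIntegral Set.left_mem_uIcc
  rw [absolutelyContinuousOnInterval_iff] at hnorm ⊢
  intro ε hε
  obtain ⟨δ, hδ, h⟩ := hnorm ε hε
  refine ⟨δ, hδ, fun E hE hlen ↦ (Finset.sum_le_sum fun i hi ↦ ?_).trans_lt (h E hE hlen)⟩
  have hint : ∀ s ∈ Set.uIcc a b, IntervalIntegrable u volume a s := fun s hs ↦
    hu.mono_set (Set.uIcc_subset_uIcc_left hs)
  obtain ⟨h1, h2⟩ := hE.1 i hi
  rw [dist_add_left, dist_eq_norm, dist_eq_norm,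
    intervalIntegral.integral_interval_sub_left (hint _ h1) (hint _ h2),
    intervalIntegral.integral_interval_sub_left (hint _ h1).norm (hint _ h2).norm,
    Real.norm_eq_abs]
  exact intervalIntegral.norm_integral_le_abs_integral_norm

/-- The contributions of a lower triangular matrix and of its adjoint to the derivative of the
pairing cancel. -/
theorem sum_adjoint_triangular {R : Type*} [CommRing R] (n : ℕ) (f fstar : ℕ → ℕ → R)
    (hfstar : ∀ k j, fstar k j = (-1) ^ (k + j + 1) * f (n - j + 1) (n - k + 1)) (y z : ℕ → R) :
    ∑ j ∈ Finset.range n, (-1) ^ j *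
        ((∑ i ∈ Finset.Icc 1 (j + 1), fstar (j + 1) i * z (i - 1)) * y (n - 1 - j)) =
      -∑ j ∈ Finset.range n, (-1) ^ j *
        (z j * ∑ i ∈ Finset.Icc 1 (n - j), f (n - j) i * y (i - 1)) := by
  simp only [Finset.sum_mul, Finset.mul_sum, ← Finset.sum_neg_distrib]
  rw [Finset.sum_sigma', Finset.sum_sigma']
  refine Finset.sum_bij' (fun p _ ↦ ⟨p.2 - 1, n - p.1⟩) (fun p _ ↦ ⟨n - p.2, p.1 + 1⟩)
    ?_ ?_ ?_ ?_ ?_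
  · rintro ⟨j, i⟩ h
    simp only [Finset.mem_sigma, Finset.mem_range, Finset.mem_Icc] at h ⊢
    omega
  · rintro ⟨j, i⟩ h
    simp only [Finset.mem_sigma, Finset.mem_range, Finset.mem_Icc] at h ⊢
    omega
  · rintro ⟨j, i⟩ h
    simp only [Finset.mem_sigma, Finset.mem_range, Finset.mem_Icc] at h
    ext
    · dsimp only; omega
    · simp only [heq_eq_eq]; omega
  · rintro ⟨j, i⟩ h
    simp only [Finset.mem_sigma, Finset.mem_range, Finset.mem_Icc] at h
    ext
    · dsimp only; omega
    · simp only [heq_eq_eq]; omega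
  · rintro ⟨j, i⟩ h
    simp only [Finset.mem_sigma, Finset.mem_range, Finset.mem_Icc] at h
    obtain ⟨i, rfl⟩ : ∃ m, i = m + 1 := ⟨i - 1, by omega⟩
    have h1 : n - (i + 1) + 1 = n - i := by omega
    have h2 : n - (j + 1) + 1 = n - j := by omega
    have h3 : n - j - 1 = n - 1 - j := by omega
    simp only [hfstar, h1, h2, h3, Nat.add_sub_cancel]
    have h4 : ((-1 : R) ^ j) * (-1) ^ j = 1 := by rw [← mul_pow]; simp
    linear_combination (-(-1 : R) ^ i * f (n - i) (n - j) * z i * y (n - 1 - j)) * h4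

/-- The pointwise Lagrange identity for quasi-derivatives. -/
theorem sum_quasi_deriv_pairing {R : Type*} [CommRing R] (n : ℕ) (f fstar : ℕ → ℕ → R)
    (hfstar : ∀ k j, fstar k j = (-1) ^ (k + j + 1) * f (n - j + 1) (n - k + 1)) (y z : ℕ → R) :
    ∑ j ∈ Finset.range n, (-1) ^ j *
        ((z (j + 1) + ∑ i ∈ Finset.Icc 1 (j + 1), fstar (j + 1) i * z (i - 1)) * y (n - 1 - j) +
          z j * (y (n - j) + ∑ i ∈ Finset.Icc 1 (n - j), f (n - j) i * y (i - 1))) =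
      z 0 * y n - (-1) ^ n * z n * y 0 := by
  have htel := Finset.sum_range_sub' (fun j ↦ (-1) ^ j * z j * y (n - j)) n
  simp only [pow_zero, one_mul, Nat.sub_zero, Nat.sub_self] at htel
  rw [← htel, ← sub_eq_zero, ← Finset.sum_sub_distrib]
  have hadj := sum_adjoint_triangular n f fstar hfstar y z
  rw [← sub_eq_zero, sub_neg_eq_add, ← Finset.sum_add_distrib] at hadj
  rw [← hadj]
  refine Finset.sum_congr rfl fun j _ ↦ ?_
  rw [show n - (j + 1) = n - 1 - j by omega]
  ring


theorem pairing_integral_identity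
    (n : ℕ) (hn : 2 ≤ n)
    (f fstar : ℕ → ℕ → ℝ → ℂ)
    (hf : ∀ k j, 1 ≤ k → k ≤ n → 1 ≤ j → j ≤ n → IntegrableOn (f k j) (Set.Ioo 0 1))
    (hfstar : ∀ k j x, fstar k j x = (-1 : ℂ) ^ (k + j + 1) * f (n - j + 1) (n - k + 1) x)
    (lam mu : ℂ) (y z : ℕ → ℝ → ℂ)
    (hy : QuasiChainInt n f y)
    (hyeq : ∀ᵐ x ∂(volume.restrict (Set.Ioo (0 : ℝ) 1)), y n x = lam * y 0 x)
    (hz : QuasiChainInt n fstar z)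
    (hzeq : ∀ᵐ x ∂(volume.restrict (Set.Ioo (0 : ℝ) 1)), (-1 : ℂ) ^ n * z n x = mu * z 0 x) :
    (∀ x ∈ Set.Icc (0 : ℝ) 1,
      ∑ j ∈ Finset.range n, (-1 : ℂ) ^ j * z j x * y (n - 1 - j) x
        = (∑ j ∈ Finset.range n, (-1 : ℂ) ^ j * z j 0 * y (n - 1 - j) 0) +
          (lam - mu) * ∫ t in (0 : ℝ)..x, y 0 t * z 0 t) ∧
    (lam = mu → ∀ x ∈ Set.Icc (0 : ℝ) 1,
      ∑ j ∈ Finset.range n, (-1 : ℂ) ^ j * z j x * y (n - 1 - j) x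
        = ∑ j ∈ Finset.range n, (-1 : ℂ) ^ j * z j 0 * y (n - 1 - j) 0) := by
  have key : ∀ x ∈ Set.Icc (0 : ℝ) 1,
      ∑ j ∈ Finset.range n, (-1 : ℂ) ^ j * z j x * y (n - 1 - j) x
        = (∑ j ∈ Finset.range n, (-1 : ℂ) ^ j * z j 0 * y (n - 1 - j) 0) +
          (lam - mu) * ∫ t in (0 : ℝ)..x, y 0 t * z 0 t := by
    have hI : ∀ {u : ℝ → ℂ}, IntegrableOn u (Set.Ioo 0 1) → IntervalIntegrable u volume 0 1 :=
      fun hu ↦ (intervalIntegrable_iff_integrableOn_Ioo_of_le zero_le_one).2 hu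
    set Gy : ℕ → ℝ → ℂ := fun k t ↦ y k t + ∑ j ∈ Finset.Icc 1 k, f k j t * y (j - 1) t
    set Gz : ℕ → ℝ → ℂ := fun k t ↦ z k t + ∑ j ∈ Finset.Icc 1 k, fstar k j t * z (j - 1) t
    have hGy : ∀ k, k < n → IntervalIntegrable (Gy (k + 1)) volume 0 1 :=
      fun k hk ↦ hI (hy (k + 1) (by omega) (by omega)).2.1
    have hGz : ∀ k, k < n → IntervalIntegrable (Gz (k + 1)) volume 0 1 :=
      fun k hk ↦ hI (hz (k + 1) (by omega) (by omega)).2.1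
    set Y : ℕ → ℝ → ℂ := fun k x ↦ y k 0 + ∫ t in (0 : ℝ)..x, Gy (k + 1) t
    set Z : ℕ → ℝ → ℂ := fun k x ↦ z k 0 + ∫ t in (0 : ℝ)..x, Gz (k + 1) t
    have hyY : ∀ k, k < n → ∀ x ∈ Set.Icc (0 : ℝ) 1, y k x = Y k x :=
      fun k hk ↦ (hy (k + 1) (by omega) (by omega)).2.2
    have hzZ : ∀ k, k < n → ∀ x ∈ Set.Icc (0 : ℝ) 1, z k x = Z k x :=
      fun k hk ↦ (hz (k + 1) (by omega) (by omega)).2.2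
    have hyz : IntervalIntegrable (fun t ↦ y 0 t * z 0 t) volume 0 1 := by
      refine ContinuousOn.intervalIntegrable ?_
      rw [Set.uIcc_of_le zero_le_one]
      exact (hy 1 le_rfl (by omega)).1.mul (hz 1 le_rfl (by omega)).1
    set W : ℝ → ℂ := fun x ↦
      ∑ j ∈ Finset.range n, (-1 : ℂ) ^ j • (Z j x • Y (n - 1 - j) x) -
        (lam - mu) • (0 + ∫ t in (0 : ℝ)..x, y 0 t * z 0 t) with hW
    have hWac : AbsolutelyContinuousOnInterval W 0 1 := by
      refine .fun_sub (.fun_sum _ fun j hj ↦ ?_) (.const_smul _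
        (absolutelyContinuousOnInterval_const_add_integral hyz 0))
      have hj := Finset.mem_range.1 hj
      exact .const_smul _ (.fun_smul
        (absolutelyContinuousOnInterval_const_add_integral (hGz j hj) _)
        (absolutelyContinuousOnInterval_const_add_integral (hGy (n - 1 - j) (by omega)) _))
    have hWd : ∀ᵐ x, x ∈ Set.uIcc (0 : ℝ) 1 → HasDerivAt W 0 x := by
      have hdy : ∀ᵐ x, ∀ k, k < n → x ∈ Set.uIcc (0 : ℝ) 1 → HasDerivAt (Y k) (Gy (k + 1) x) x := by
        refine ae_all_iff.2 fun k ↦ Filter.eventually_imp_distrib_left.2 fun hk ↦ ?_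
        filter_upwards [(hGy k hk).ae_hasDerivAt_integral] with x hx hx01
        exact (hx hx01 0 (by simp)).const_add _
      have hdz : ∀ᵐ x, ∀ k, k < n → x ∈ Set.uIcc (0 : ℝ) 1 → HasDerivAt (Z k) (Gz (k + 1) x) x := by
        refine ae_all_iff.2 fun k ↦ Filter.eventually_imp_distrib_left.2 fun hk ↦ ?_
        filter_upwards [(hGz k hk).ae_hasDerivAt_integral] with x hx hx01
        exact (hx hx01 0 (by simp)).const_add _
      rw [← ae_restrict_iff' measurableSet_uIcc, Set.uIcc_of_le zero_le_one,
        ← restrict_Ioo_eq_restrict_Icc]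
      filter_upwards [hyeq, hzeq, ae_restrict_of_ae hdy, ae_restrict_of_ae hdz,
        ae_restrict_of_ae hyz.ae_hasDerivAt_integral, ae_restrict_mem measurableSet_Ioo]
        with x hyx hzx hdyx hdzx hyzx hx
      have hx' : x ∈ Set.Icc (0 : ℝ) 1 := Set.Ioo_subset_Icc_self hx
      rw [← Set.uIcc_of_le zero_le_one] at hx'
      have hsum := HasDerivAt.fun_sum (u := Finset.range n) fun j hj ↦
        have hj := Finset.mem_range.1 hj
        ((hdzx j hj hx').smul (hdyx (n - 1 - j) (by omega) hx')).const_smul ((-1 : ℂ) ^ j)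
      have hd := hsum.sub (((hyzx hx' 0 (by simp)).const_add 0).const_smul (lam - mu))
      rw [Set.uIcc_of_le zero_le_one] at hx'
      convert! hd using 1
      have halg := sum_quasi_deriv_pairing n (fun k j ↦ f k j x) (fun k j ↦ fstar k j x)
        (fun k j ↦ hfstar k j x) (fun k ↦ y k x) (fun k ↦ z k x)
      rw [hyx, hzx] at halg
      rw [eq_comm, sub_eq_zero, smul_eq_mul,
        show (lam - mu) * (y 0 x * z 0 x) = z 0 x * (lam * y 0 x) - mu * z 0 x * y 0 x by ring,
        ← halg]
      refine Finset.sum_congr rfl fun j hj ↦ ?_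
      have hj := Finset.mem_range.1 hj
      rw [← hyY _ (by omega) x hx', ← hzZ _ hj x hx', show n - 1 - j + 1 = n - j by omega]
      simp only [smul_eq_mul, Gy, Gz]
      ring
    obtain ⟨C, hC⟩ := hWac.const_of_ae_hasDerivAt_zero hWd
    rw [Set.uIcc_of_le zero_le_one] at hC
    have hWp : ∀ x ∈ Set.Icc (0 : ℝ) 1, W x =
        ∑ j ∈ Finset.range n, (-1 : ℂ) ^ j * z j x * y (n - 1 - j) x -
          (lam - mu) * ∫ t in (0 : ℝ)..x, y 0 t * z 0 t := by
      intro x hx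
      simp only [hW, zero_add, smul_eq_mul]
      congr 1
      refine Finset.sum_congr rfl fun j hj ↦ ?_
      have hj := Finset.mem_range.1 hj
      rw [hyY _ (by omega) x hx, hzZ _ hj x hx, mul_assoc]
    intro x hx
    have h0 : (0 : ℝ) ∈ Set.Icc (0 : ℝ) 1 := by simp
    have h := (hC x hx).trans (hC 0 h0).symm
    rw [hWp x hx, hWp 0 h0, intervalIntegral.integral_same, mul_zero, sub_zero] at h
    exact sub_eq_iff_eq_add.1 h
  exact ⟨key, fun h x hx ↦ by rw [key x hx, h]; simp⟩
end

section
/- Let n ≥ 2, let F = (f_{k,j})_{k,j=1}^n be a matrix-valued function on (0,1) with complex integrable entries, let F⋆ be its adjoint, and let λ, μ ∈ ℂ. For each r = 1,…,n let (y_{r,0},…,y_{r,n}) be a quasi-derivative chain with respect to F holding in integrated form on [0,1] with y_{r,n} = λ·y_{r,0} a.e., and let (z_{r,0},…,z_{r,n}) be a quasi-derivative chain with respect to F⋆ holding in integrated form on [0,1] with (−1)^n·z_{r,n} = μ·z_{r,0} a.e. Let Φ(x) (respectively Φ⋆(x)) be the n×n matrix whose (k,r) entry is y_{r,k−1}(x)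 (respectively z_{r,k−1}(x)), and let J be the n×n matrix whose only nonzero entries are J_{k,n+1−k} = (−1)^{k+1}. Then for all x ∈ [0,1] and all r, r′: the (r,r′) entry of Φ⋆(x)ᵀ J Φ(x) equals the (r,r′) entry of Φ⋆(0)ᵀ J Φ(0) plus (λ − μ)·∫_0^x z_{r,0}(t)·y_{r′,0}(t) dt. -/
open MeasureTheory Matrix

/-- An indefinite integral of an integrable complex-valued function is absolutely continuous. -/
theorem absolutelyContinuousOnInterval_integral_complex {g : ℝ → ℂ} {a b : ℝ}
    (hg : IntervalIntegrable g volume a b) :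
    AbsolutelyContinuousOnInterval (fun x => ∫ t in a..x, g t) a b := by
  have hre : IntervalIntegrable (fun t => (g t).re) volume a b :=
    ⟨hg.1.re, hg.2.re⟩
  have him : IntervalIntegrable (fun t => (g t).im) volume a b :=
    ⟨hg.1.im, hg.2.im⟩
  have hconst (c : ℂ) : AbsolutelyContinuousOnInterval (fun _ : ℝ => c) a b :=
    (LipschitzWith.const c).lipschitzOnWith.absolutelyContinuousOnInterval
  have hsum :=
    ((hre.absolutelyContinuousOnInterval_intervalIntegral (c := a) (by simp)).fun_smul
      (hconst 1)).fun_add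
    ((him.absolutelyContinuousOnInterval_intervalIntegral (c := a) (by simp)).fun_smul
      (hconst Complex.I))
  rw [absolutelyContinuousOnInterval_iff] at hsum ⊢
  have key : ∀ x ∈ Set.uIcc a b, ((∫ t in a..x, (g t).re) • (1 : ℂ) +
      (∫ t in a..x, (g t).im) • Complex.I) = ∫ t in a..x, g t := by
    intro x hx
    have hgx : IntervalIntegrable g volume a x := hg.mono_set (Set.uIcc_subset_uIcc_left hx)
    apply Complex.ext
    · have := Complex.reCLM.intervalIntegral_comp_comm hgx
      simpa using this
    · have := Complex.imCLM.intervalIntegral_comp_comm hgx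
      simpa using this
  intro ε hε
  obtain ⟨δ, hδ, h⟩ := hsum ε hε
  refine ⟨δ, hδ, fun E hE hlt => ?_⟩
  refine lt_of_eq_of_lt (Finset.sum_congr rfl fun i hi => ?_) (h E hE hlt)
  rw [key _ (hE.1 i hi).1, key _ (hE.1 i hi).2]

/-- The product rule in integrated form for two indefinite integrals. -/
theorem mul_eq_add_integral_of_eq_add_integral {u v u' v' : ℝ → ℂ} {a b : ℝ}
    (hu' : IntervalIntegrable u' volume a b) (hv' : IntervalIntegrable v' volume a b)
    (hu : ∀ x ∈ Set.uIcc a b, u x = u a + ∫ t in a..x, u' t)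
    (hv : ∀ x ∈ Set.uIcc a b, v x = v a + ∫ t in a..x, v' t) :
    IntervalIntegrable (fun t => u' t * v t + u t * v' t) volume a b ∧
    ∀ x ∈ Set.uIcc a b,
      u x * v x = u a * v a + ∫ t in a..x, (u' t * v t + u t * v' t) := by
  let U : ℝ → ℂ := fun x => u a + ∫ t in a..x, u' t
  let V : ℝ → ℂ := fun x => v a + ∫ t in a..x, v' t
  have hconst (c : ℂ) : AbsolutelyContinuousOnInterval (fun _ : ℝ => c) a b :=
    (LipschitzWith.const c).lipschitzOnWith.absolutelyContinuousOnInterval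
  have hU : AbsolutelyContinuousOnInterval U a b :=
    (hconst _).fun_add (absolutelyContinuousOnInterval_integral_complex hu')
  have hV : AbsolutelyContinuousOnInterval V a b :=
    (hconst _).fun_add (absolutelyContinuousOnInterval_integral_complex hv')
  have hcu : ContinuousOn u (Set.uIcc a b) := hU.continuousOn.congr hu
  have hcv : ContinuousOn v (Set.uIcc a b) := hV.continuousOn.congr hv
  have hint : IntervalIntegrable (fun t => u' t * v t + u t * v' t) volume a b :=
    (hu'.mul_continuousOn hcv).add (hv'.continuousOn_mul hcu)
  refine ⟨hint, ?_⟩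
  have hG : AbsolutelyContinuousOnInterval
      (fun x => U x • V x - ∫ t in a..x, (u' t * v t + u t * v' t)) a b :=
    (hU.fun_smul hV).fun_sub (absolutelyContinuousOnInterval_integral_complex hint)
  have hG0 : ∀ᵐ x, x ∈ Set.uIcc a b → HasDerivAt
      (fun x => U x • V x - ∫ t in a..x, (u' t * v t + u t * v' t)) 0 x := by
    filter_upwards [hu'.ae_hasDerivAt_integral, hv'.ae_hasDerivAt_integral,
      hint.ae_hasDerivAt_integral] with x h1 h2 h3 hx
    have d := ((((h1 hx a (by simp)).const_add (u a)).mul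
      ((h2 hx a (by simp)).const_add (v a))).sub (h3 hx a (by simp)))
    rw [← hu x hx, ← hv x hx, sub_self] at d
    exact d
  obtain ⟨C, hC⟩ := hG.const_of_ae_hasDerivAt_zero hG0
  intro x hx
  have e := (hC x hx).trans (hC a (by simp)).symm
  simp only [U, V, ← hu x hx, ← hv x hx, intervalIntegral.integral_same, smul_eq_mul,
    add_zero, sub_zero] at e
  exact sub_eq_iff_eq_add.mp e

/-- The Lagrange identity: in the pairing of the expressions of a chain and an adjoint chain, the
coefficient terms cancel and the remaining terms telescope. -/
theorem sum_adjoint_pairing {R : Type*} [CommRing R] (n : ℕ) (f fstar : ℕ → ℕ → R)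
    (hfstar : ∀ k j, fstar k j = (-1) ^ (k + j + 1) * f (n - j + 1) (n - k + 1))
    (Y Z : ℕ → R) :
    ∑ k ∈ Finset.range n, (-1) ^ k *
      ((Z (k + 1) + ∑ j ∈ Finset.Icc 1 (k + 1), fstar (k + 1) j * Z (j - 1)) * Y (n - 1 - k) +
        Z k * (Y (n - k) + ∑ j ∈ Finset.Icc 1 (n - k), f (n - k) j * Y (j - 1))) =
      Z 0 * Y n - (-1) ^ n * Z n * Y 0 := by
  have hcancel : ∑ k ∈ Finset.range n, ∑ j ∈ Finset.Icc 1 (k + 1),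
        (-1) ^ k * (fstar (k + 1) j * Z (j - 1) * Y (n - 1 - k)) =
      ∑ k ∈ Finset.range n, ∑ j ∈ Finset.Icc 1 (n - k),
        -((-1) ^ k * (Z k * (f (n - k) j * Y (j - 1)))) := by
    rw [Finset.sum_sigma', Finset.sum_sigma']
    refine Finset.sum_bij' (fun p _ => ⟨p.2 - 1, n - p.1⟩) (fun p _ => ⟨n - p.2, p.1 + 1⟩)
      ?_ ?_ ?_ ?_ ?_
    · rintro ⟨k, j⟩ h
      simp only [Finset.mem_sigma, Finset.mem_range, Finset.mem_Icc] at h ⊢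
      omega
    · rintro ⟨k, j⟩ h
      simp only [Finset.mem_sigma, Finset.mem_range, Finset.mem_Icc] at h ⊢
      omega
    · rintro ⟨k, j⟩ h
      simp only [Finset.mem_sigma, Finset.mem_range, Finset.mem_Icc] at h
      simp only [Sigma.mk.injEq, heq_eq_eq]
      omega
    · rintro ⟨k, j⟩ h
      simp only [Finset.mem_sigma, Finset.mem_range, Finset.mem_Icc] at h
      simp only [Sigma.mk.injEq, heq_eq_eq]
      omega
    · rintro ⟨k, j⟩ h
      simp only [Finset.mem_sigma, Finset.mem_range, Finset.mem_Icc] at h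
      obtain ⟨l, rfl⟩ : ∃ l, j = l + 1 := ⟨j - 1, by omega⟩
      have e1 : n - (l + 1) + 1 = n - l := by omega
      have e2 : n - (k + 1) + 1 = n - k := by omega
      have e3 : n - 1 - k = n - k - 1 := by omega
      have e4 : ((-1 : R)) ^ k * (-1) ^ (k + 1 + (l + 1) + 1) = -(-1) ^ l := by
        rw [← pow_add, show k + (k + 1 + (l + 1) + 1) = 2 * (k + 1) + (l + 1) by ring, pow_add,
          pow_mul]
        simp [pow_succ]
      simp only [hfstar, e1, e2, e3, Nat.add_sub_cancel]
      linear_combination f (n - l) (n - k) * Z l * Y (n - k - 1) * e4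
  have htel := Finset.sum_range_sub' (fun k => (-1) ^ k * Z k * Y (n - k)) n
  simp only [pow_zero, one_mul, Nat.sub_zero, Nat.sub_self] at htel
  rw [← htel, ← sub_eq_zero, ← Finset.sum_sub_distrib]
  simp only [← Finset.mul_sum, ← Finset.sum_mul, Finset.sum_neg_distrib] at hcancel
  rw [← add_eq_zero_iff_eq_neg, ← Finset.sum_add_distrib] at hcancel
  rw [← hcancel]
  refine Finset.sum_congr rfl fun k _ => ?_
  rw [show n - (k + 1) = n - 1 - k by omega]
  ring

/-- Under the antidiagonal sign matrix, matrix pairing is an alternating sum. -/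
theorem transpose_mul_antidiagonal_mul_apply {R : Type*} [CommRing R] {n : ℕ}
    (A B J : Matrix (Fin n) (Fin n) R)
    (hJ : ∀ k j : Fin n, J k j = if (k : ℕ) + (j : ℕ) + 1 = n then (-1) ^ (k : ℕ) else 0)
    (a b : ℕ → R) (r r' : Fin n) (ha : ∀ k : Fin n, A k r = a k)
    (hb : ∀ k : Fin n, B k r' = b k) :
    (Aᵀ * J * B) r r' = ∑ k ∈ Finset.range n, (-1) ^ k * (a k * b (n - 1 - k)) := by
  rw [Matrix.mul_assoc, Matrix.mul_apply, Finset.sum_range]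
  refine Finset.sum_congr rfl fun k _ => ?_
  rw [Matrix.mul_apply, Finset.sum_eq_single (Fin.rev k)]
  · have h : (k : ℕ) + (Fin.rev k : ℕ) + 1 = n := by rw [Fin.val_rev]; omega
    rw [Matrix.transpose_apply, ha, hb, hJ, if_pos h,
      show ((Fin.rev k : Fin n) : ℕ) = n - 1 - k by rw [Fin.val_rev]; omega]
    ring
  · intro j _ hj
    rw [hJ, if_neg, zero_mul]
    intro h
    exact hj (Fin.ext (by rw [Fin.val_rev]; omega))
  · simp

theorem matrix_pairing_integral_identity
    (n : ℕ) (hn : 2 ≤ n)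
    (f fstar : ℕ → ℕ → ℝ → ℂ)
    (hf : ∀ k j, 1 ≤ k → k ≤ n → 1 ≤ j → j ≤ n → IntegrableOn (f k j) (Set.Ioo 0 1))
    (hfstar : ∀ k j x, fstar k j x = (-1 : ℂ) ^ (k + j + 1) * f (n - j + 1) (n - k + 1) x)
    (lam mu : ℂ) (y z : Fin n → ℕ → ℝ → ℂ)
    (hy : ∀ r, QuasiChainInt n f (y r))
    (hyeq : ∀ r, ∀ᵐ x ∂(volume.restrict (Set.Ioo (0 : ℝ) 1)), y r n x = lam * y r 0 x)
    (hz : ∀ r, QuasiChainInt n fstar (z r))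
    (hzeq : ∀ r, ∀ᵐ x ∂(volume.restrict (Set.Ioo (0 : ℝ) 1)),
      (-1 : ℂ) ^ n * z r n x = mu * z r 0 x)
    (Φ Φstar : ℝ → Matrix (Fin n) (Fin n) ℂ)
    (hΦ : ∀ x, ∀ k r : Fin n, Φ x k r = y r (k : ℕ) x)
    (hΦstar : ∀ x, ∀ k r : Fin n, Φstar x k r = z r (k : ℕ) x)
    (J : Matrix (Fin n) (Fin n) ℂ)
    (hJ : ∀ k j : Fin n, J k j =
      if (k : ℕ) + (j : ℕ) + 1 = n then (-1 : ℂ) ^ (k : ℕ) else 0) :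
    ∀ x ∈ Set.Icc (0 : ℝ) 1, ∀ r r' : Fin n,
      ((Φstar x)ᵀ * J * Φ x) r r'
        = ((Φstar 0)ᵀ * J * Φ 0) r r' +
          (lam - mu) * ∫ t in (0 : ℝ)..x, z r 0 t * y r' 0 t := by
  intro x hx r r'
  have hIoo {g : ℝ → ℂ} (hg : IntegrableOn g (Set.Ioo 0 1)) :
      IntervalIntegrable g volume 0 1 := by
    rwa [intervalIntegrable_iff_integrableOn_Ioo_of_le zero_le_one]
  have hx' : x ∈ Set.uIcc (0 : ℝ) 1 := by rwa [Set.uIcc_of_le zero_le_one]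
  have hprod : ∀ k ∈ Finset.range n, _ := fun k hk => by
    have hkn := Finset.mem_range.mp hk
    obtain ⟨-, hzi, hze⟩ := hz r (k + 1) (by omega) (by omega)
    obtain ⟨-, hyi, hye⟩ := hy r' (n - k) (by omega) (by omega)
    rw [← Set.uIcc_of_le zero_le_one] at hze hye
    rw [show n - k - 1 = n - 1 - k by omega] at hye
    rw [Nat.add_sub_cancel] at hze
    exact mul_eq_add_integral_of_eq_add_integral (hIoo hzi) (hIoo hyi) hze hye
  rw [transpose_mul_antidiagonal_mul_apply _ _ J hJ (fun k => z r k x) (fun k => y r' k x) r r'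
      (fun k => hΦstar x k r) (fun k => hΦ x k r'),
    transpose_mul_antidiagonal_mul_apply _ _ J hJ (fun k => z r k 0) (fun k => y r' k 0) r r'
      (fun k => hΦstar 0 k r) (fun k => hΦ 0 k r')]
  rw [Finset.sum_congr rfl fun k hk => congrArg ((-1) ^ k * ·) ((hprod k hk).2 x hx')]
  simp only [mul_add ((-1) ^ _ : ℂ) (_ * _) (intervalIntegral _ _ _ _), Finset.sum_add_distrib,
    ← intervalIntegral.integral_const_mul]
  rw [← intervalIntegral.integral_finsetSum fun k hk =>
    ((hprod k hk).1.mono_set (Set.uIcc_subset_uIcc_left hx')).const_mul _]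
  congr 1
  have hae : ∀ᵐ t, t ∈ Set.Ioo (0 : ℝ) 1 →
      y r' n t = lam * y r' 0 t ∧ (-1 : ℂ) ^ n * z r n t = mu * z r 0 t := by
    rw [← ae_restrict_iff' measurableSet_Ioo]
    exact (hyeq r').and (hzeq r)
  refine intervalIntegral.integral_congr_ae ?_
  filter_upwards [hae, Measure.ae_ne volume (1 : ℝ)] with t ht ht1 htx
  rw [Set.uIoc_of_le hx.1] at htx
  obtain ⟨e1, e2⟩ := ht ⟨htx.1, lt_of_le_of_ne (htx.2.trans hx.2) ht1⟩
  have := sum_adjoint_pairing n (fun k j => f k j t) (fun k j => fstar k j t)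
    (fun k j => hfstar k j t) (fun k => y r' k t) (fun k => z r k t)
  rw [this, e1, e2]
  ring
end

section
/- Let J₀, M₀, M⋆₀ be invertible n×n complex matrices and let M₋₁, M⋆₋₁ be n×n complex matrices satisfying M₋₁·J₀⁻¹·(M⋆₋₁)ᵀ = 0 and M₀·J₀⁻¹·(M⋆₋₁)ᵀ + M₋₁·J₀⁻¹·(M⋆₀)ᵀ = 0. Define N := M₀⁻¹·M₋₁ and N⋆ := (M⋆₀)⁻¹·M⋆₋₁. Then (N⋆)ᵀ = −J₀·N·J₀⁻¹ and N² = 0. -/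
open Matrix

theorem spectral_data_matrix_relations
    (n : ℕ) (J₀ M₀ Mst₀ Mneg Mstneg : Matrix (Fin n) (Fin n) ℂ)
    (hJ₀ : IsUnit J₀) (hM₀ : IsUnit M₀) (hMst₀ : IsUnit Mst₀)
    (h1 : Mneg * J₀⁻¹ * Mstnegᵀ = 0)
    (h2 : M₀ * J₀⁻¹ * Mstnegᵀ + Mneg * J₀⁻¹ * Mst₀ᵀ = 0) :
    (Mst₀⁻¹ * Mstneg)ᵀ = -(J₀ * (M₀⁻¹ * Mneg) * J₀⁻¹) ∧
      (M₀⁻¹ * Mneg) * (M₀⁻¹ * Mneg) = 0 := by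
  have hJ := (isUnit_iff_isUnit_det J₀).mp hJ₀
  have hM := (isUnit_iff_isUnit_det M₀).mp hM₀
  have hS : Mst₀ᵀ * Mst₀⁻¹ᵀ = 1 := by
    rw [← transpose_mul, nonsing_inv_mul _ ((isUnit_iff_isUnit_det Mst₀).mp hMst₀),
      transpose_one]
  have hstar : (Mst₀⁻¹ * Mstneg)ᵀ = -(J₀ * (M₀⁻¹ * Mneg) * J₀⁻¹) := by
    have hneg : Mstnegᵀ = -(J₀ * (M₀⁻¹ * Mneg) * J₀⁻¹ * Mst₀ᵀ) := by
      calc Mstnegᵀ = J₀ * (M₀⁻¹ * (M₀ * J₀⁻¹ * Mstnegᵀ)) := by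
            rw [Matrix.mul_assoc M₀, nonsing_inv_mul_cancel_left _ _ hM,
              mul_nonsing_inv_cancel_left _ _ hJ]
        _ = -(J₀ * (M₀⁻¹ * Mneg) * J₀⁻¹ * Mst₀ᵀ) := by
            rw [eq_neg_of_add_eq_zero_left h2]
            simp only [Matrix.mul_neg, Matrix.mul_assoc]
    rw [transpose_mul, hneg, Matrix.neg_mul, Matrix.mul_assoc _ Mst₀ᵀ, hS, Matrix.mul_one]
  refine ⟨hstar, ?_⟩
  have hzero : Mneg * (M₀⁻¹ * Mneg) * J₀⁻¹ = 0 := by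
    calc Mneg * (M₀⁻¹ * Mneg) * J₀⁻¹
        = -(Mneg * J₀⁻¹ * -(J₀ * (M₀⁻¹ * Mneg) * J₀⁻¹)) := by
          simp only [Matrix.mul_neg, neg_neg, Matrix.mul_assoc,
            nonsing_inv_mul_cancel_left _ _ hJ]
      _ = 0 := by
          rw [← hstar, transpose_mul, ← Matrix.mul_assoc, h1, Matrix.zero_mul, neg_zero]
  rw [Matrix.mul_assoc, ← nonsing_inv_mul_cancel_right J₀ (Mneg * (M₀⁻¹ * Mneg)) hJ, hzero,
    Matrix.zero_mul, Matrix.mul_zero]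
end

section
/- Let n ≥ 1 and let J₀, J₁ be n×n complex matrices whose entries vanish except possibly on the antidiagonal (i.e., the (k,j) entry is zero unless k + j = n + 1). Let L, L⋆ be lower triangular n×n complex matrices with all diagonal entries equal to 1, and let V, V⋆ be upper triangular n×n complex matrices. If (L⋆)ᵀ·J₀·L = (V⋆)ᵀ·J₁·V, then (L⋆)ᵀ·J₀·L = J₀. -/
open Matrix

section Antidiagonal

variable {n : ℕ} {R : Type*} [CommSemiring R] {J A B : Matrix (Fin n) (Fin n) R}

theorem transpose_mul_mul_apply_of_lower
    (hJ : ∀ k j : Fin n, (k : ℕ) + (j : ℕ) + 1 ≠ n → J k j = 0)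
    (hA : ∀ i j : Fin n, i < j → A i j = 0) (hB : ∀ i j : Fin n, i < j → B i j = 0)
    {i j : Fin n} (hij : n ≤ (i : ℕ) + j + 1) :
    (Aᵀ * J * B) i j = A i i * J i j * B j j := by
  simp only [Matrix.mul_apply, Matrix.transpose_apply, Finset.sum_mul]
  rw [Finset.sum_eq_single j, Finset.sum_eq_single i]
  · intro k _ hk
    rcases lt_or_gt_of_ne hk with hk | hk
    · simp [hA k i hk]
    · simp [hJ k j (by have : (i : ℕ) < k := hk; omega)]
  · simp
  · intro l _ hl
    refine Finset.sum_eq_zero fun k _ => ?_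
    rcases lt_or_gt_of_ne hl with hl | hl
    · simp [hB l j hl]
    · rcases lt_or_ge k i with hk | hk
      · simp [hA k i hk]
      · simp [hJ k l (by have : (j : ℕ) < l := hl; have : (i : ℕ) ≤ k := hk; omega)]
  · simp

theorem transpose_mul_mul_apply_of_upper
    (hJ : ∀ k j : Fin n, (k : ℕ) + (j : ℕ) + 1 ≠ n → J k j = 0)
    (hA : ∀ i j : Fin n, j < i → A i j = 0) (hB : ∀ i j : Fin n, j < i → B i j = 0)
    {i j : Fin n} (hij : (i : ℕ) + j + 1 < n) :
    (Aᵀ * J * B) i j = 0 := by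
  simp only [Matrix.mul_apply, Matrix.transpose_apply, Finset.sum_mul]
  refine Finset.sum_eq_zero fun l _ => Finset.sum_eq_zero fun k _ => ?_
  rcases lt_or_ge j l with hl | hl
  · simp [hB l j hl]
  · rcases lt_or_ge i k with hk | hk
    · simp [hA k i hk]
    · simp [hJ k l (by have : (l : ℕ) ≤ j := hl; have : (k : ℕ) ≤ i := hk; omega)]

end Antidiagonal

theorem antidiagonal_triangular_identity
    (n : ℕ) (hn : 1 ≤ n)
    (J₀ J₁ L Lst V Vst : Matrix (Fin n) (Fin n) ℂ)
    (hJ₀ : ∀ k j : Fin n, (k : ℕ) + (j : ℕ) + 1 ≠ n → J₀ k j = 0)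
    (hJ₁ : ∀ k j : Fin n, (k : ℕ) + (j : ℕ) + 1 ≠ n → J₁ k j = 0)
    (hL : ∀ i j : Fin n, i < j → L i j = 0) (hLdiag : ∀ i : Fin n, L i i = 1)
    (hLst : ∀ i j : Fin n, i < j → Lst i j = 0) (hLstdiag : ∀ i : Fin n, Lst i i = 1)
    (hV : ∀ i j : Fin n, j < i → V i j = 0)
    (hVst : ∀ i j : Fin n, j < i → Vst i j = 0)
    (h : Lstᵀ * J₀ * L = Vstᵀ * J₁ * V) :
    Lstᵀ * J₀ * L = J₀ := by
  ext i j
  rcases lt_or_ge ((i : ℕ) + j + 1) n with hij | hij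
  · rw [h, transpose_mul_mul_apply_of_upper hJ₁ hVst hV hij, hJ₀ i j hij.ne]
  · rw [transpose_mul_mul_apply_of_lower hJ₀ hLst hL hij, hLstdiag, hLdiag, one_mul, mul_one]
end

section
/- Let ξ : ℕ → ℝ be a nonnegative sequence with Σ_l ξ_l² < ∞, let C ≥ 0, and let R : ℕ × ℕ → ℂ satisfy |R(l₀,l)| ≤ C·ξ_l/(|l − l₀| + 1) for all l₀, l ∈ ℕ. Then: (1) for every bounded sequence α : ℕ → ℂ and every l₀, the series Σ_l R(l₀,l)·α_l converges absolutely, and T(α) := (Σ_l R(l₀,l)·α_l)_{l₀∈ℕ} is again a bounded sequence, so T defines a bounded linear operator on the Banach space ℓ∞(ℕ,ℂ) of bounded complex sequences with the supremum norm; (2) for each N ∈ ℕ, the operator T_N with kernel R_N(l₀,l) := R(l₀,l) for l ≤ N and R_N(l₀,l) := 0 for l > N has finite-dimensional range, and the operator norm ‖T − T_N‖ tends to 0 as N → ∞; consequently T is a compact operator on ℓ∞(ℕ,ℂ). -/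
open Filter Topology ENNReal

theorem summable_one_div_abs_add_one_sq :
    Summable fun n : ℤ => (1 / (|(n : ℝ)| + 1)) ^ 2 := by
  have h : Summable fun n : ℕ => (1 / ((n : ℝ) + 1)) ^ 2 := by
    have := (summable_nat_add_iff 1).2 (Real.summable_one_div_nat_pow.2 one_lt_two)
    simpa [one_div, inv_pow] using this
  refine Summable.of_nat_of_neg ?_ ?_ <;> simpa using h

/-- Cauchy-Schwarz bound, uniform in the row index `i`, for the rows of the kernel
`ξ l / (|l - i| + 1)`. -/
theorem sum_div_abs_sub_add_one_le {ξ : ℕ → ℝ} (hξ : Summable fun l => ξ l ^ 2)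
    (i : ℤ) (s : Finset ℕ) :
    ∑ l ∈ s, ξ l / (|(l : ℝ) - i| + 1) ≤
      √(∑' l, ξ l ^ 2) * √(∑' n : ℤ, (1 / (|(n : ℝ)| + 1)) ^ 2) := by
  have hinj : Function.Injective fun l : ℕ => (l : ℤ) - i := fun a b h => by
    simpa using h
  have hw : ∑ l ∈ s, (1 / (|(l : ℝ) - i| + 1)) ^ 2 ≤
      ∑' n : ℤ, (1 / (|(n : ℝ)| + 1)) ^ 2 := by
    have := summable_one_div_abs_add_one_sq.sum_le_tsum (s.map ⟨_, hinj⟩)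
      fun _ _ => sq_nonneg _
    simpa using this
  calc ∑ l ∈ s, ξ l / (|(l : ℝ) - i| + 1)
      = ∑ l ∈ s, ξ l * (1 / (|(l : ℝ) - i| + 1)) := by simp only [mul_one_div]
    _ ≤ √(∑ l ∈ s, ξ l ^ 2) * √(∑ l ∈ s, (1 / (|(l : ℝ) - i| + 1)) ^ 2) :=
      Real.sum_mul_le_sqrt_mul_sqrt _ _ _
    _ ≤ _ := by
      gcongr
      exact hξ.sum_le_tsum s fun _ _ => sq_nonneg _

theorem summable_norm_mul_and_norm_tsum_mul_le {a α : ℕ → ℂ} {M B : ℝ}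
    (ha : ∀ s : Finset ℕ, ∑ l ∈ s, ‖a l‖ ≤ M) (hα : ∀ l, ‖α l‖ ≤ B) :
    (Summable fun l => ‖a l * α l‖) ∧ ‖∑' l, a l * α l‖ ≤ M * B := by
  have hB : 0 ≤ B := (norm_nonneg _).trans (hα 0)
  have hsum (s : Finset ℕ) : ∑ l ∈ s, ‖a l * α l‖ ≤ M * B :=
    calc ∑ l ∈ s, ‖a l * α l‖ ≤ ∑ l ∈ s, ‖a l‖ * B := by
          gcongr with l _
          rw [norm_mul]
          gcongr
          exact hα l
      _ = (∑ l ∈ s, ‖a l‖) * B := (Finset.sum_mul _ _ _).symm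
      _ ≤ M * B := by gcongr; exact ha s
  have hs := summable_of_sum_le (fun _ => norm_nonneg _) hsum
  exact ⟨hs, (norm_tsum_le_tsum_norm hs).trans (hs.tsum_le_of_sum_le hsum)⟩

/-- A kernel with uniformly bounded absolute row sums defines a bounded operator on `ℓ∞`. -/
theorem exists_clm_of_sum_norm_le {K : ℕ → ℕ → ℂ} {M : ℝ}
    (hK : ∀ i, ∀ s : Finset ℕ, ∑ l ∈ s, ‖K i l‖ ≤ M) :
    ∃ T : lp (fun _ : ℕ => ℂ) ∞ →L[ℂ] lp (fun _ : ℕ => ℂ) ∞,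
      ∀ α i, (T α) i = ∑' l, K i l * α l := by
  have hM : 0 ≤ M := by simpa using hK 0 ∅
  have key (α : lp (fun _ : ℕ => ℂ) ∞) (i : ℕ) :=
    summable_norm_mul_and_norm_tsum_mul_le (hK i) (lp.norm_apply_le_norm top_ne_zero α)
  let T : lp (fun _ : ℕ => ℂ) ∞ →ₗ[ℂ] lp (fun _ : ℕ => ℂ) ∞ :=
    { toFun := fun α => ⟨fun i => ∑' l, K i l * α l, memℓp_infty ⟨M * ‖α‖, by
        rintro _ ⟨i, rfl⟩
        exact (key α i).2⟩⟩
      map_add' := fun α β => by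
        ext i
        change ∑' l, K i l * (α l + β l) = ∑' l, K i l * α l + ∑' l, K i l * β l
        simp only [mul_add]
        exact (key α i).1.of_norm.tsum_add (key β i).1.of_norm
      map_smul' := fun c α => by
        ext i
        change ∑' l, K i l * (c * α l) = c * ∑' l, K i l * α l
        simp only [mul_left_comm _ c]
        exact tsum_mul_left }
  exact ⟨T.mkContinuous M fun α =>
    lp.norm_le_of_forall_le (by positivity) fun i => (key α i).2, fun _ _ => rfl⟩

theorem isCompactOperator_of_finiteDimensional_range {E F : Type*}
    [NormedAddCommGroup E] [NormedSpace ℂ E] [NormedAddCommGroup F] [NormedSpace ℂ F]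
    (f : E →L[ℂ] F) [FiniteDimensional ℂ (LinearMap.range f.toLinearMap)] :
    IsCompactOperator f := by
  let V := LinearMap.range f.toLinearMap
  have : ProperSpace V := FiniteDimensional.proper ℂ V
  have h : IsCompactOperator (f.codRestrict V fun x => ⟨x, rfl⟩) :=
    isCompactOperator_of_locallyCompactSpace_dom _
  exact h.clm_comp V.subtypeL

theorem finiteDimensional_range_sum_smulRight {ι E F : Type*}
    [NormedAddCommGroup E] [NormedSpace ℂ E] [NormedAddCommGroup F] [NormedSpace ℂ F]
    (s : Finset ι) (φ : ι → E →L[ℂ] ℂ) (v : ι → F) :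
    FiniteDimensional ℂ
      (LinearMap.range (∑ i ∈ s, (φ i).smulRight (v i)).toLinearMap) := by
  have : FiniteDimensional ℂ (Submodule.span ℂ (v '' s)) :=
    FiniteDimensional.span_of_finite ℂ (s.finite_toSet.image v)
  refine Submodule.finiteDimensional_of_le (S₂ := Submodule.span ℂ (v '' s)) ?_
  rintro _ ⟨x, rfl⟩
  simp only [ContinuousLinearMap.coe_coe, _root_.sum_apply,
    ContinuousLinearMap.smulRight_apply]
  exact Submodule.sum_mem _ fun i hi =>
    Submodule.smul_mem _ _ (Submodule.subset_span ⟨i, hi, rfl⟩)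

theorem main_equation_operator_compact
    (ξ : ℕ → ℝ) (hξpos : ∀ l, 0 ≤ ξ l) (hξ : Summable fun l => (ξ l) ^ 2)
    (C : ℝ) (hC : 0 ≤ C) (R : ℕ → ℕ → ℂ)
    (hR : ∀ l₀ l, ‖R l₀ l‖ ≤ C * ξ l / (|(l : ℝ) - (l₀ : ℝ)| + 1)) :
    -- (1) absolute convergence and boundedness for every bounded sequence
    (∀ α : ℕ → ℂ, (∃ Cb : ℝ, ∀ l, ‖α l‖ ≤ Cb) →
      (∀ l₀, Summable fun l => ‖R l₀ l * α l‖) ∧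
      ∃ Cb' : ℝ, ∀ l₀, ‖∑' l, R l₀ l * α l‖ ≤ Cb') ∧
    -- T is a bounded linear operator on ℓ∞(ℕ, ℂ), approximated by the
    -- finite-rank truncations T_N, hence compact
    ∃ T : lp (fun _ : ℕ => ℂ) ∞ →L[ℂ] lp (fun _ : ℕ => ℂ) ∞,
      ∃ TN : ℕ → (lp (fun _ : ℕ => ℂ) ∞ →L[ℂ] lp (fun _ : ℕ => ℂ) ∞),
        (∀ α : lp (fun _ : ℕ => ℂ) ∞, ∀ l₀ : ℕ, (T α) l₀ = ∑' l, R l₀ l * α l) ∧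
        (∀ N : ℕ, ∀ α : lp (fun _ : ℕ => ℂ) ∞, ∀ l₀ : ℕ,
          (TN N α) l₀ = ∑ l ∈ Finset.range (N + 1), R l₀ l * α l) ∧
        (∀ N : ℕ, FiniteDimensional ℂ (LinearMap.range (TN N).toLinearMap)) ∧
        Tendsto (fun N => ‖T - TN N‖) atTop (𝓝 0) ∧
        IsCompactOperator T := by
  set W : ℝ := √(∑' n : ℤ, (1 / (|(n : ℝ)| + 1)) ^ 2)
  have htail (k i : ℕ) (s : Finset ℕ) :
      ∑ l ∈ s, ‖R i (l + k)‖ ≤ C * (√(∑' l, ξ (l + k) ^ 2) * W) := by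
    have h := sum_div_abs_sub_add_one_le ((summable_nat_add_iff k).2 hξ) ((i : ℤ) - k) s
    refine le_trans ?_ (mul_le_mul_of_nonneg_left h hC)
    rw [Finset.mul_sum]
    refine Finset.sum_le_sum fun l _ => (hR i (l + k)).trans_eq ?_
    push_cast
    rw [mul_div_assoc, sub_sub_eq_add_sub]
  have hrow : ∀ i, ∀ s : Finset ℕ, ∑ l ∈ s, ‖R i l‖ ≤ C * (√(∑' l, ξ l ^ 2) * W) :=
    htail 0
  refine ⟨fun α ⟨B, hB⟩ =>
    ⟨fun i => (summable_norm_mul_and_norm_tsum_mul_le (hrow i) hB).1,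
      _, fun i => (summable_norm_mul_and_norm_tsum_mul_le (hrow i) hB).2⟩, ?_⟩
  obtain ⟨T, hT⟩ := exists_clm_of_sum_norm_le hrow
  let TN (N : ℕ) : lp (fun _ : ℕ => ℂ) ∞ →L[ℂ] lp (fun _ : ℕ => ℂ) ∞ :=
    ∑ l ∈ Finset.range (N + 1),
      (lp.evalCLM ℂ (fun _ : ℕ => ℂ) ∞ l).smulRight (T (lp.single ∞ l 1))
  have hcol (i l : ℕ) : (T (lp.single ∞ l 1)) i = R i l := by
    rw [hT, tsum_eq_single l fun j hj => by rw [lp.single_apply_ne _ _ _ hj, mul_zero],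
      lp.single_apply_self, mul_one]
  have hTN (N : ℕ) (α : lp (fun _ : ℕ => ℂ) ∞) (i : ℕ) :
      (TN N α) i = ∑ l ∈ Finset.range (N + 1), R i l * α l := by
    simp only [TN, _root_.sum_apply, ContinuousLinearMap.smulRight_apply,
      lp.coeFn_sum, Finset.sum_apply, lp.coeFn_smul, Pi.smul_apply, hcol, smul_eq_mul]
    exact Finset.sum_congr rfl fun l _ => mul_comm _ _
  have hfin (N : ℕ) : FiniteDimensional ℂ (LinearMap.range (TN N).toLinearMap) :=
    finiteDimensional_range_sum_smulRight _ _ _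
  have hbound (N : ℕ) : ‖T - TN N‖ ≤ C * (√(∑' l, ξ (l + (N + 1)) ^ 2) * W) := by
    refine ContinuousLinearMap.opNorm_le_bound _ (by positivity) fun α => ?_
    refine lp.norm_le_of_forall_le (by positivity) fun i => ?_
    have hα := lp.norm_apply_le_norm top_ne_zero α
    have hs := (summable_norm_mul_and_norm_tsum_mul_le (hrow i) hα).1.of_norm
    have heq : ((T - TN N) α) i = ∑' l, R i (l + (N + 1)) * α (l + (N + 1)) := by
      rw [_root_.sub_apply, lp.coeFn_sub, Pi.sub_apply, hT, hTN,
        ← hs.sum_add_tsum_nat_add (N + 1), add_sub_cancel_left]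
    rw [heq]
    exact (summable_norm_mul_and_norm_tsum_mul_le (htail (N + 1) i) fun l => hα _).2
  have hlim : Tendsto (fun N => ‖T - TN N‖) atTop (𝓝 0) := by
    refine squeeze_zero (fun _ => norm_nonneg _) hbound ?_
    have h0 := (_root_.tendsto_sum_nat_add fun l => ξ l ^ 2).comp (tendsto_add_atTop_nat 1)
    simpa using (h0.sqrt.mul_const W).const_mul C
  refine ⟨T, TN, hT, hTN, hfin, hlim, ?_⟩
  have hconv : Tendsto TN atTop (𝓝 T) := by
    rw [tendsto_iff_norm_sub_tendsto_zero]
    simpa only [norm_sub_rev] using hlim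
  exact isCompactOperator_of_tendsto hconv <| .of_forall fun N =>
    isCompactOperator_of_finiteDimensional_range (TN N)
end

section
/- Let n ≥ 2 be an even integer and let s be an integer with 1 ≤ s ≤ n − 1. Then Σ_{r=n−s}^{n} (−1)^r · C(n,r) · C(r−1, n−s−1) + (−1)^{s+1} = 0, where C(a,b) denotes the binomial coefficient a choose b. -/
theorem sum_range_alternating_choose_mul_choose {n m : ℕ} (h : n ≠ m) :
    ∑ r ∈ Finset.range (n + 1), (-1 : ℤ) ^ r * n.choose r * r.choose m = 0 := by
  have key := fwdDiff_iter_choose_zero m n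
  rw [if_neg h, fwdDiff_iter_eq_sum_shift] at key
  rw [← mul_zero ((-1 : ℤ) ^ n), ← key, Finset.mul_sum]
  refine Finset.sum_congr rfl fun r hr ↦ ?_
  obtain ⟨d, rfl⟩ := Nat.exists_eq_add_of_le (Finset.mem_range_succ_iff.mp hr)
  have hd : (-1 : ℤ) ^ d * (-1) ^ d = 1 := by rw [← mul_pow]; simp
  simp only [Nat.add_sub_cancel_left, smul_eq_mul, mul_one, zero_add, pow_add]
  linear_combination (-(-1 : ℤ) ^ r * (r + d).choose r * r.choose m) * hd

theorem sum_range_alternating_choose_succ_mul_choose {n k : ℕ} (h : k < n) :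
    ∑ r ∈ Finset.range n, (-1 : ℤ) ^ r * n.choose (r + 1) * r.choose k = (-1) ^ k := by
  induction k with
  | zero =>
    have key := sum_range_alternating_choose_mul_choose h.ne'
    rw [Finset.sum_range_succ'] at key
    simp only [pow_succ, mul_neg, neg_mul, mul_one, Finset.sum_neg_distrib, Nat.choose_zero_right,
      Nat.cast_one, pow_zero] at key ⊢
    linarith
  | succ k ih =>
    have key := sum_range_alternating_choose_mul_choose h.ne'
    rw [Finset.sum_range_succ'] at key
    simp only [Nat.choose_succ_succ' _ k, Nat.choose_zero_succ, pow_succ, mul_neg, neg_mul, mul_one,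
      Finset.sum_neg_distrib, Nat.cast_add, mul_add, Finset.sum_add_distrib, Nat.cast_zero,
      mul_zero] at key ⊢
    linarith [ih (by lia)]

theorem regularization_constants_vanish
    (n s : ℕ) (hn : 2 ≤ n) (hneven : Even n) (hs1 : 1 ≤ s) (hs2 : s ≤ n - 1) :
    (∑ r ∈ Finset.Icc (n - s) n,
        (-1 : ℤ) ^ r * (n.choose r) * ((r - 1).choose (n - s - 1))) +
      (-1 : ℤ) ^ (s + 1) = 0 := by
  obtain ⟨k, rfl⟩ : ∃ k, n = k + (s + 1) := ⟨n - s - 1, by lia⟩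
  have hk : k + (s + 1) - s = k + 1 := by lia
  have hsign : (-1 : ℤ) ^ (s + 1) = (-1) ^ k := by
    have h := Nat.even_add.mp hneven
    rcases Nat.even_or_odd k with hke | hko
    · rw [hke.neg_one_pow, (h.mp hke).neg_one_pow]
    · rw [hko.neg_one_pow, (Nat.not_even_iff_odd.mp
        (fun hs ↦ Nat.not_even_iff_odd.mpr hko (h.mpr hs))).neg_one_pow]
  rw [hk, Nat.add_sub_cancel, hsign]
  have hsub : Finset.Icc (k + 1) (k + (s + 1)) ⊆ Finset.Ico 1 (k + (s + 1) + 1) := by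
    intro r hr
    simp only [Finset.mem_Icc, Finset.mem_Ico] at hr ⊢
    lia
  rw [Finset.sum_subset hsub, Finset.sum_Ico_eq_sum_range,
    ← sum_range_alternating_choose_succ_mul_choose (show k < k + (s + 1) by lia),
    Nat.add_sub_cancel, ← Finset.sum_add_distrib]
  · refine Finset.sum_eq_zero fun r _ ↦ ?_
    rw [Nat.add_sub_cancel_left, add_comm 1 r]
    ring
  · intro r hr hr'
    simp only [Finset.mem_Icc, Finset.mem_Ico] at hr hr'
    rw [Nat.choose_eq_zero_of_lt (show r - 1 < k by lia), Nat.cast_zero, mul_zero]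
end
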